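/- Let p ≥ 1 and let x_1, x_2, …, x_p be strings over Σ, each of length at least m. Regard each M_{x_t} and each T_{x_t, x_{t+1}} as an (m+1)×(m+1) matrix over the Boolean semiring ({false, true}, ∨, ∧), with rows and columns indexed by 0, …, m. Then the (0,0) entry of the matrix product M_{x_1} × T_{x_1,x_2} × M_{x_2} × T_{x_2,x_3} × ⋯ × T_{x_{p−1},x_p} × M_{x_p} is true if and only if the concatenation x_1 x_2 ⋯ x_p belongs to 𝒟*. -/

import Mathlib

open Classical

/-- `s` belongs to the Kleene star of the dictionary `D`:
`s` is a concatenation of finitely many (possibly zero) words of `D`. -/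
def InStar {σ : Type*} (D : Finset (List σ)) (s : List σ) : Prop :=
  ∃ fs : List (List σ), (∀ f ∈ fs, f ∈ D) ∧ fs.flatten = s

/-- The Boolean matrix `M_x`, of size `(m+1) × (m+1)`, indexed by `0,…,m`:
`M_x[i,j] = true` iff `i + j ≤ |x|` and the string `x` with its first `i` and
last `j` characters removed belongs to `D*`. -/
noncomputable def MmatB {σ : Type*} (D : Finset (List σ)) (m : ℕ) (x : List σ) :
    Matrix (Fin (m + 1)) (Fin (m + 1)) Bool :=
  fun i j => decide ((i : ℕ) + (j : ℕ) ≤ x.length ∧ InStar D ((x.drop i).rdrop j))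

/-- The Boolean matrix `T_{a,b}`, of size `(m+1) × (m+1)`, indexed by `0,…,m`:
`T_{a,b}[k,ℓ] = true` iff `k ≤ |a|`, `ℓ ≤ |b|`, and the concatenation of the last `k`
characters of `a` with the first `ℓ` characters of `b` is a word of `D`. -/
noncomputable def TmatB {σ : Type*} (D : Finset (List σ)) (m : ℕ) (a b : List σ) :
    Matrix (Fin (m + 1)) (Fin (m + 1)) Bool :=
  fun k ℓ => decide ((k : ℕ) ≤ a.length ∧ (ℓ : ℕ) ≤ b.length ∧ (a.rtake k ++ b.take ℓ) ∈ D)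

/-- Multiplication of Boolean matrices over the Boolean semiring `({false,true}, ∨, ∧)`. -/
noncomputable def bmul {d : ℕ} (A B : Matrix (Fin d) (Fin d) Bool) :
    Matrix (Fin d) (Fin d) Bool :=
  fun i j => decide (∃ t : Fin d, A i t = true ∧ B t j = true)

/-- The chained product `M_{x_1} × T_{x_1,x_2} × M_{x_2} × ⋯ × T_{x_{p-1},x_p} × M_{x_p}`
over the Boolean semiring, for the nonempty list of strings `x_1, …, x_p`
(on the empty list it is the identity matrix). -/
noncomputable def chainProd {σ : Type*} (D : Finset (List σ)) (m : ℕ) :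
    List (List σ) → Matrix (Fin (m + 1)) (Fin (m + 1)) Bool
  | [] => fun i j => decide (i = j)
  | [x] => MmatB D m x
  | x :: y :: rest => bmul (bmul (MmatB D m x) (TmatB D m x y)) (chainProd D m (y :: rest))

theorem InStar.append {σ : Type*} {D : Finset (List σ)} {s t : List σ}
    (hs : InStar D s) (ht : InStar D t) : InStar D (s ++ t) := by
  obtain ⟨fs, hfs, rfl⟩ := hs
  obtain ⟨gs, hgs, rfl⟩ := ht
  refine ⟨fs ++ gs, fun f hf => ?_, by simp⟩
  rcases List.mem_append.1 hf with h | h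
  exacts [hfs f h, hgs f h]

theorem InStar.of_mem {σ : Type*} {D : Finset (List σ)} {s : List σ}
    (hs : s ∈ D) : InStar D s :=
  ⟨[s], by simpa using hs, by simp⟩

/-- A factorization of `u ++ v` with `v` nonempty has a factor starting within `u` or right
after it, and ending within `v` or right before it. -/
theorem InStar.exists_straddling {σ : Type*} {D : Finset (List σ)} {u v : List σ} (hv : v ≠ [])
    (h : InStar D (u ++ v)) :
    ∃ u₁ u₂ v₁ v₂, u = u₁ ++ u₂ ∧ v = v₁ ++ v₂ ∧ InStar D u₁ ∧ u₂ ++ v₁ ∈ D ∧ InStar D v₂ := by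
  obtain ⟨fs, hfs, h⟩ := h
  induction fs generalizing u with
  | nil => simp_all
  | cons f fs ih =>
    have hf : f ∈ D := hfs f (by simp)
    have hfs' : ∀ g ∈ fs, g ∈ D := fun g hg => hfs g (by simp [hg])
    rw [List.flatten_cons, List.append_eq_append_iff] at h
    rcases h with ⟨w, rfl, hw⟩ | ⟨w, rfl, hw⟩
    · obtain ⟨u₁, u₂, v₁, v₂, rfl, rfl, h₁, h₂, h₃⟩ := ih hfs' hw
      exact ⟨f ++ u₁, u₂, v₁, v₂, by simp, rfl, (InStar.of_mem hf).append h₁, h₂, h₃⟩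
    · exact ⟨[], u, w, fs.flatten, rfl, hw, ⟨[], by simp, rfl⟩, hf, ⟨fs, hfs', rfl⟩⟩

theorem chainProd_apply_zero {σ : Type*} {D : Finset (List σ)} {m : ℕ} (hm : 0 < m)
    (hD : ∀ d ∈ D, d.length ≤ m) {xs : List (List σ)} (hp : xs ≠ [])
    (hlen : ∀ x ∈ xs, m ≤ x.length) (i : Fin (m + 1)) :
    chainProd D m xs i 0 = true ↔ InStar D (xs.flatten.drop i) := by
  induction xs generalizing i with
  | nil => exact absurd rfl hp
  | cons x xs ih =>
    have hx : m ≤ x.length := hlen x (by simp)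
    have hi : (i : ℕ) ≤ x.length := by omega
    cases xs with
    | nil => simp [chainProd, MmatB, hi]
    | cons y rest =>
      have hy : m ≤ y.length := hlen y (by simp)
      have ih := ih (by simp) (fun z hz => hlen z (by simp [hz]))
      simp only [chainProd, bmul, decide_eq_true_eq, ih, MmatB, TmatB]
      rw [List.flatten_cons (l := x), List.drop_append_of_le_length hi]
      constructor
      · rintro ⟨ℓ, ⟨k, ⟨hk, hM⟩, ⟨-, hℓ, hT⟩⟩, hS⟩
        have hu : x.drop i = (x.drop i).rdrop k ++ x.rtake k := by
          rw [List.rdrop, List.rtake, List.length_drop]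
          conv_lhs => rw [← List.take_append_drop (x.length - i - k) (x.drop i)]
          rw [List.drop_drop]
          congr 2
          omega
        have hv : (y :: rest).flatten = y.take ℓ ++ (y :: rest).flatten.drop ℓ := by
          rw [List.flatten_cons, List.drop_append_of_le_length hℓ, ← List.append_assoc,
            List.take_append_drop]
        rw [hu, hv]
        simpa using hM.append ((InStar.of_mem hT).append hS)
      · intro h
        have hne : (y :: rest).flatten ≠ [] := by
          intro h0
          have := congrArg List.length h0
          simp only [List.flatten_cons, List.length_append, List.length_nil] at this
          omega
        obtain ⟨u₁, u₂, v₁, v₂, hu, hv, h₁, h₂, h₃⟩ := h.exists_straddling hne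
        have hlen₂ := hD _ h₂
        rw [List.length_append] at hlen₂
        have hul := congrArg List.length hu
        rw [List.length_drop, List.length_append] at hul
        have hx_eq : x = (x.take i ++ u₁) ++ u₂ := by
          rw [List.append_assoc, ← hu, List.take_append_drop]
        have hrtake : x.rtake u₂.length = u₂ := by
          rw [hx_eq, List.rtake, List.length_append, Nat.add_sub_cancel, List.drop_left]
        have htake : y.take v₁.length = v₁ := by
          have := congrArg (List.take v₁.length) hv
          rwa [List.flatten_cons, List.take_append_of_le_length (by omega),
            List.take_left] at this
        refine ⟨⟨v₁.length, by omega⟩, ⟨⟨u₂.length, by omega⟩, ⟨?_, ?_⟩, ?_, ?_, ?_⟩, ?_⟩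
        · dsimp only; omega
        · simpa [hu, List.rdrop] using h₁
        · dsimp only; omega
        · dsimp only; omega
        · simpa [hrtake, htake] using h₂
        · rw [hv, List.drop_left]
          exact h₃

theorem stmt4 {σ : Type*} [Fintype σ] (D : Finset (List σ)) (hD : D.Nonempty)
    (hne : ∀ d ∈ D, d ≠ []) (m : ℕ) (hm : m = D.sup List.length)
    (xs : List (List σ)) (hp : xs ≠ []) (hlen : ∀ x ∈ xs, m ≤ x.length) :
    chainProd D m xs 0 0 = true ↔ InStar D xs.flatten := by
  have hle : ∀ d ∈ D, d.length ≤ m := fun d hd => hm ▸ Finset.le_sup (f := List.length) hd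
  obtain ⟨d, hd⟩ := hD
  have hpos : 0 < m := (List.length_pos_iff.2 (hne d hd)).trans_le (hle d hd)
  simpa using chainProd_apply_zero hpos hle hp hlen 0
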